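/- Let d ≥ 1, let ρ, μ ∈ P_1(ℝ^d) both be centered, and let γ be a Borel probability measure on ℝ^d × ℝ^d with marginals ρ and μ such that ∫ ⟨x,y⟩ dγ(x,y) = T(ρ,μ) < ∞. Then for every point (x,y) in the topological support of γ one has ⟨x,y⟩ + T(ρ,μ) ≥ 0. -/

import Mathlib

open MeasureTheory Real Filter Topology
open scoped ENNReal RealInnerProductSpace

noncomputable section

/-- `d`-dimensional Euclidean space. -/
abbrev Ed (d : ℕ) := EuclideanSpace ℝ (Fin d)

open Classical in
/-- The entropy `E(ρ) = ∫ f ln f dx` (extended-real-valued, computed as positive part minus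
negative part of the integral of `f ln f`, where `f` is the density), and `+∞` if `ρ` is not
absolutely continuous w.r.t. Lebesgue measure. -/
def entropy {d : ℕ} (ρ : Measure (Ed d)) : EReal :=
  if ρ ≪ (volume : Measure (Ed d)) then
    ((∫⁻ x, ENNReal.ofReal ((ρ.rnDeriv volume x).toReal *
        Real.log (ρ.rnDeriv volume x).toReal) : ℝ≥0∞) : EReal)
      - ((∫⁻ x, ENNReal.ofReal (-((ρ.rnDeriv volume x).toReal *
        Real.log (ρ.rnDeriv volume x).toReal)) : ℝ≥0∞) : EReal)
  else ⊤

/-- The (extended-real-valued) integral `∫ ⟨x,y⟩ dγ(x,y)`: positive part minus negative part. -/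
def pairInt {d : ℕ} (γ : Measure (Ed d × Ed d)) : EReal :=
  ((∫⁻ p, ENNReal.ofReal (⟪p.1, p.2⟫ : ℝ) ∂γ : ℝ≥0∞) : EReal)
    - ((∫⁻ p, ENNReal.ofReal (-(⟪p.1, p.2⟫ : ℝ)) ∂γ : ℝ≥0∞) : EReal)

/-- Transport plans: probability measures on the product with marginals `ρ` and `μ`. -/
def Couplings {d : ℕ} (ρ μ : Measure (Ed d)) : Set (Measure (Ed d × Ed d)) :=
  {γ | IsProbabilityMeasure γ ∧ γ.fst = ρ ∧ γ.snd = μ}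

/-- The maximal correlation functional `T(ρ,μ) = sup { ∫⟨x,y⟩ dγ : γ ∈ Π(ρ,μ) }`. -/
def maxCorr {d : ℕ} (ρ μ : Measure (Ed d)) : EReal :=
  ⨆ γ ∈ Couplings ρ μ, pairInt γ

/-- `ρ` has finite first moment. -/
def FirstMoment {d : ℕ} (ρ : Measure (Ed d)) : Prop := Integrable (fun x => ‖x‖) ρ

/-- `ρ` is centered: its barycenter is `0`. -/
def Centered {d : ℕ} (ρ : Measure (Ed d)) : Prop := (∫ x, x ∂ρ) = 0

/-- Weak convergence of measures: convergence of integrals of bounded continuous functions. -/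
def WeakConv {d : ℕ} (ρs : ℕ → Measure (Ed d)) (ρ : Measure (Ed d)) : Prop :=
  ∀ f : BoundedContinuousFunction (Ed d) ℝ,
    Tendsto (fun n => ∫ x, f x ∂(ρs n)) atTop (𝓝 (∫ x, f x ∂ρ))

/-- Convexity for extended-real-valued functions on `Ed d`. -/
def EConvexOn {d : ℕ} (u : Ed d → EReal) : Prop :=
  ∀ x y : Ed d, ∀ a b : ℝ, 0 ≤ a → 0 ≤ b → a + b = 1 →
    u (a • x + b • y) ≤ (a : EReal) * u x + (b : EReal) * u y

/-- `e^{-t}` for `t ∈ ℝ ∪ {+∞}`, with `e^{-∞} = 0`. -/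
def expNegE (t : EReal) : ℝ := if t = ⊤ then 0 else Real.exp (-t.toReal)

/-- The Legendre transform `u*(y) = sup_x (⟨x,y⟩ - u(x))`. -/
def legendre {d : ℕ} (u : Ed d → EReal) (y : Ed d) : EReal :=
  ⨆ x : Ed d, (((⟪x, y⟫ : ℝ) : EReal) - u x)

/-- The essential continuity of a convex l.s.c. function `u : ℝ^d → ℝ ∪ {+∞}`:
`u` tends to `+∞` at `H^{d-1}`-a.e. point of the boundary of its domain. -/
def EssentiallyContinuous {d : ℕ} (u : Ed d → EReal) : Prop :=
  μH[(d : ℝ) - 1] {x : Ed d | x ∈ frontier {y | u y < ⊤} ∧ u x < ⊤} = 0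

/-- For an integrable pairing the extended integral is the Bochner integral. -/
lemma pairInt_eq_integral {d : ℕ} {γ : Measure (Ed d × Ed d)}
    (h : Integrable (fun p => (⟪p.1, p.2⟫ : ℝ)) γ) :
    pairInt γ = ((∫ p, (⟪p.1, p.2⟫ : ℝ) ∂γ : ℝ) : EReal) := by
  have hp : ∫⁻ p, ENNReal.ofReal (⟪p.1, p.2⟫ : ℝ) ∂γ ≠ ∞ := h.lintegral_lt_top.ne
  have hn : ∫⁻ p, ENNReal.ofReal (-(⟪p.1, p.2⟫ : ℝ)) ∂γ ≠ ∞ := h.neg.lintegral_lt_top.ne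
  rw [pairInt, integral_eq_lintegral_pos_part_sub_lintegral_neg_part h, EReal.coe_sub,
    EReal.coe_ennreal_toReal hp, EReal.coe_ennreal_toReal hn]

lemma integrable_inner_prod {d : ℕ} {α β : Measure (Ed d)} [IsFiniteMeasure α]
    [IsFiniteMeasure β] (hα : FirstMoment α) (hβ : FirstMoment β) :
    Integrable (fun p : Ed d × Ed d => (⟪p.1, p.2⟫ : ℝ)) (α.prod β) := by
  refine (Integrable.mul_prod hα hβ).mono' (by fun_prop) (.of_forall fun p => ?_)
  exact norm_inner_le_norm p.1 p.2

lemma integral_inner_prod {d : ℕ} {α β : Measure (Ed d)} [IsFiniteMeasure α]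
    [IsFiniteMeasure β] (hα : FirstMoment α) (hβ : FirstMoment β) :
    ∫ p : Ed d × Ed d, (⟪p.1, p.2⟫ : ℝ) ∂(α.prod β) = ⟪∫ x, x ∂α, ∫ y, y ∂β⟫ := by
  have hα' : Integrable (fun x : Ed d => x) α := (integrable_norm_iff (by fun_prop)).1 hα
  have hβ' : Integrable (fun x : Ed d => x) β := (integrable_norm_iff (by fun_prop)).1 hβ
  rw [integral_prod _ (integrable_inner_prod hα hβ)]
  simp_rw [integral_inner hβ', real_inner_comm (∫ y, y ∂β)]
  rw [integral_inner hα', real_inner_comm]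

/-- A mass-swapping competitor: the part of `γ` in `U` is replaced by products of its marginals
with `ρ` and `μ`. -/
lemma swap_mem_couplings {d : ℕ} {ρ μ : Measure (Ed d)} [IsProbabilityMeasure ρ]
    [IsProbabilityMeasure μ] {γ : Measure (Ed d × Ed d)} (hγ : γ ∈ Couplings ρ μ)
    {U : Set (Ed d × Ed d)} (hU : MeasurableSet U) :
    (1 + γ U)⁻¹ • (γ.restrict Uᶜ + ((γ.restrict U).fst.prod μ + ρ.prod (γ.restrict U).snd))
      ∈ Couplings ρ μ := by
  obtain ⟨hγp, h1, h2⟩ := hγ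
  have hne : (1 + γ U) ≠ 0 := by simp
  have hnt : (1 + γ U) ≠ ∞ := by finiteness
  have hfst : ((1 + γ U)⁻¹ • (γ.restrict Uᶜ + ((γ.restrict U).fst.prod μ +
      ρ.prod (γ.restrict U).snd))).fst = ρ := by
    rw [Measure.fst, Measure.map_smul, ← Measure.fst, Measure.fst_add, Measure.fst_add, Measure.fst_prod, ← add_assoc,
      ← Measure.fst_add, add_comm (γ.restrict Uᶜ), Measure.restrict_add_restrict_compl hU, h1]
    have h3 : (ρ.prod (γ.restrict U).snd).fst = γ U • ρ := by
      rw [Measure.fst, Measure.map_fst_prod, Measure.snd_univ, Measure.restrict_apply_univ]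
    nth_rw 1 [h3, ← one_smul ℝ≥0∞ ρ]
    rw [← add_smul, smul_smul, ENNReal.inv_mul_cancel hne hnt, one_smul]
  have hsnd : ((1 + γ U)⁻¹ • (γ.restrict Uᶜ + ((γ.restrict U).fst.prod μ +
      ρ.prod (γ.restrict U).snd))).snd = μ := by
    rw [add_comm ((γ.restrict U).fst.prod μ), Measure.snd, Measure.map_smul, ← Measure.snd,
      Measure.snd_add, Measure.snd_add, Measure.snd_prod, ← add_assoc,
      ← Measure.snd_add, add_comm (γ.restrict Uᶜ), Measure.restrict_add_restrict_compl hU, h2]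
    have h3 : ((γ.restrict U).fst.prod μ).snd = γ U • μ := by
      rw [Measure.snd, Measure.map_snd_prod, Measure.fst_univ, Measure.restrict_apply_univ]
    nth_rw 1 [h3, ← one_smul ℝ≥0∞ μ]
    rw [← add_smul, smul_smul, ENNReal.inv_mul_cancel hne hnt, one_smul]
  refine ⟨⟨?_⟩, hfst, hsnd⟩
  rw [← Measure.fst_univ, hfst, measure_univ]

lemma FirstMoment.mono {d : ℕ} {α ρ : Measure (Ed d)} (hρ : FirstMoment ρ) (h : α ≤ ρ) :
    FirstMoment α :=
  Integrable.mono_measure hρ h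

/-- on the support of an optimal plan `γ` for two centered measures one has
`⟨x,y⟩ + T(ρ,μ) ≥ 0`. -/
theorem inner_add_maxCorr_nonneg_on_support {d : ℕ} (hd : 1 ≤ d)
    (ρ μ : Measure (Ed d)) [IsProbabilityMeasure ρ] [IsProbabilityMeasure μ]
    (hρ1 : FirstMoment ρ) (hμ1 : FirstMoment μ) (hρc : Centered ρ) (hμc : Centered μ)
    (γ : Measure (Ed d × Ed d)) (hγ : γ ∈ Couplings ρ μ)
    (hint : Integrable (fun p => (⟪p.1, p.2⟫ : ℝ)) γ)
    (hopt : ((∫ p, (⟪p.1, p.2⟫ : ℝ) ∂γ : ℝ) : EReal) = maxCorr ρ μ) :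
    ∀ x y : Ed d,
      (∀ U : Set (Ed d × Ed d), IsOpen U → (x, y) ∈ U → 0 < γ U) →
      (0 : EReal) ≤ ((⟪x, y⟫ : ℝ) : EReal) + maxCorr ρ μ := by
  obtain ⟨hγp, h1, h2⟩ := id hγ
  intro x y hxy
  set T : ℝ := ∫ p, (⟪p.1, p.2⟫ : ℝ) ∂γ
  rw [← hopt, ← EReal.coe_add, EReal.coe_nonneg]
  by_contra! hlt
  let U : Set (Ed d × Ed d) := {p | (⟪p.1, p.2⟫ : ℝ) < -T}
  have hUo : IsOpen U := isOpen_lt (by fun_prop) continuous_const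
  have hU : MeasurableSet U := hUo.measurableSet
  have hpos : 0 < γ U := hxy U hUo (show (⟪x, y⟫ : ℝ) < -T by linarith)
  have hf : FirstMoment (γ.restrict U).fst :=
    hρ1.mono (h1 ▸ Measure.map_mono Measure.restrict_le_self measurable_fst)
  have hs : FirstMoment (γ.restrict U).snd :=
    hμ1.mono (h2 ▸ Measure.map_mono Measure.restrict_le_self measurable_snd)
  have i1 := integrable_inner_prod hf hμ1
  have i2 := integrable_inner_prod hρ1 hs
  have e1 := integral_inner_prod hf hμ1
  have e2 := integral_inner_prod hρ1 hs
  rw [show ∫ y, y ∂μ = 0 from hμc, inner_zero_right] at e1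
  rw [show ∫ x, x ∂ρ = 0 from hρc, inner_zero_left] at e2
  have iU : Integrable (fun p => (⟪p.1, p.2⟫ : ℝ)) (γ.restrict Uᶜ) := hint.restrict
  have isum := iU.add_measure (i1.add_measure i2)
  have hle := le_iSup₂ (f := fun γ (_ : γ ∈ Couplings ρ μ) => pairInt γ) _
    (swap_mem_couplings hγ hU)
  change _ ≤ maxCorr ρ μ at hle
  rw [pairInt_eq_integral (isum.smul_measure (by simp)), ← hopt, EReal.coe_le_coe_iff,
    integral_smul_measure, integral_add_measure iU (i1.add_measure i2),
    integral_add_measure i1 i2, e1, e2, ENNReal.toReal_inv,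
    ENNReal.toReal_add (by simp) (by finiteness), ENNReal.toReal_one, smul_eq_mul, add_zero,
    add_zero] at hle
  have hm : 0 < (γ U).toReal := ENNReal.toReal_pos hpos.ne' (by finiteness)
  rw [inv_mul_le_iff₀ (by linarith)] at hle
  have hsplit : ∫ p in U, (⟪p.1, p.2⟫ : ℝ) ∂γ + ∫ p in Uᶜ, (⟪p.1, p.2⟫ : ℝ) ∂γ = T :=
    integral_add_compl hU hint
  have hUlt : 0 < ∫ p in U, (-T - (⟪p.1, p.2⟫ : ℝ)) ∂γ := by
    rw [setIntegral_pos_iff_support_of_nonneg_ae]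
    · refine hpos.trans_le (measure_mono fun p hp => ⟨?_, hp⟩)
      exact (sub_pos.2 hp).ne'
    · exact (ae_restrict_iff' hU).2 (.of_forall fun p hp => (sub_pos.2 hp).le)
    · exact ((integrable_const _).sub hint).integrableOn
  rw [integral_sub (integrable_const _) hint.restrict, setIntegral_const, smul_eq_mul,
    measureReal_def] at hUlt
  linarith
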